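/- arXiv:2205.13056 — 5 statements merged into one kernel-verified Lean document; each statement's English description precedes it below -/
import Mathlib

section
/- Let v, w, w' be unit vectors in ℝ^d with ⟨w', v⟩ = 0 and ‖w − w'‖ ≤ ε. Then there exists a unit vector u ∈ ℝ^d with ⟨u, w⟩ = 0 and ‖v − u‖ ≤ ε. In other words, every unit vector orthogonal to some point of the ε-ball around w on the sphere lies within distance ε of the great subsphere {u ∈ S^{d−1} : ⟨u, w⟩ = 0}. -/
open scoped RealInnerProductSpace

section UnitVectors

variable {E : Type*} [NormedAddCommGroup E] [InnerProductSpace ℝ E]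

theorem norm_sub_le_norm_sub_iff_inner_le_inner {x y z t : E}
    (hx : ‖x‖ = 1) (hy : ‖y‖ = 1) (hz : ‖z‖ = 1) (ht : ‖t‖ = 1) :
    ‖x - y‖ ≤ ‖z - t‖ ↔ ⟪z, t⟫ ≤ ⟪x, y⟫ := by
  rw [← sq_le_sq₀ (norm_nonneg _) (norm_nonneg _), norm_sub_sq_real, norm_sub_sq_real,
    hx, hy, hz, ht]
  constructor <;> intro h <;> linarith

/-- Bessel's inequality for an orthonormal pair. -/
theorem inner_sq_add_inner_sq_le_norm_sq {x y : E} (hx : ‖x‖ = 1) (hy : ‖y‖ = 1)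
    (hxy : ⟪x, y⟫ = 0) (z : E) : ⟪x, z⟫ ^ 2 + ⟪y, z⟫ ^ 2 ≤ ‖z‖ ^ 2 := by
  have hon : Orthonormal ℝ ![x, y] := by simp [hx, hy, hxy]
  simpa [Fin.sum_univ_two] using hon.sum_inner_products_le z (s := Finset.univ)

theorem exists_unit_orthogonal_inner_le_inner {v w w' : E} (hv : ‖v‖ = 1) (hw : ‖w‖ = 1)
    (hw' : ‖w'‖ = 1) (horth : ⟪w', v⟫ = 0) :
    ∃ u : E, ‖u‖ = 1 ∧ ⟪u, w⟫ = 0 ∧ ⟪w, w'⟫ ≤ ⟪v, u⟫ := by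
  have bessel := inner_sq_add_inner_sq_le_norm_sq hw' hv horth w
  rw [hw, real_inner_comm] at bessel
  set p := v - ⟪v, w⟫ • w with hp
  have hpw : ⟪p, w⟫ = 0 := by
    simp [hp, inner_sub_left, real_inner_smul_left, hw]
  have hvp : ⟪v, p⟫ = 1 - ⟪v, w⟫ ^ 2 := by
    simp [hp, inner_sub_right, real_inner_smul_right, hv, sq]
  have hpp : ‖p‖ ^ 2 = 1 - ⟪v, w⟫ ^ 2 := by
    rw [← hvp, ← real_inner_self_eq_norm_sq]
    nth_rw 1 [hp]
    rw [inner_sub_left, real_inner_smul_left, real_inner_comm, real_inner_comm p w, hpw,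
      real_inner_comm]
    ring
  rcases eq_or_ne p 0 with h0 | h0
  · have hww' : ⟪w, w'⟫ = 0 := by
      rw [h0, norm_zero] at hpp
      nlinarith
    exact ⟨w', hw', by rw [real_inner_comm, hww'],
      by rw [hww', real_inner_comm, horth]⟩
  · refine ⟨‖p‖⁻¹ • p, norm_smul_inv_norm h0, by rw [real_inner_smul_left, hpw, mul_zero], ?_⟩
    have hvu : ⟪v, ‖p‖⁻¹ • p⟫ = ‖p‖ := by
      rw [real_inner_smul_right, hvp, ← hpp, sq, inv_mul_cancel_left₀ (norm_ne_zero_iff.2 h0)]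
    rw [hvu]
    exact (abs_le_of_sq_le_sq' (by linarith) (norm_nonneg p)).2

end UnitVectors

/-- If `v, w, w'` are unit vectors in `ℝ^d` with `⟪w', v⟫ = 0` and `‖w - w'‖ ≤ ε`, then
there is a unit vector `u` with `⟪u, w⟫ = 0` and `‖v - u‖ ≤ ε`: every unit vector
orthogonal to some point of the `ε`-ball around `w` on the sphere lies within distance
`ε` of the great subsphere `{u ∈ S^{d-1} : ⟪u, w⟫ = 0}`. -/
theorem orthogonal_vector_close_to_great_subsphere (d : ℕ) (ε : ℝ)
    (v w w' : EuclideanSpace ℝ (Fin d))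
    (hv : ‖v‖ = 1) (hw : ‖w‖ = 1) (hw' : ‖w'‖ = 1)
    (horth : ⟪w', v⟫ = 0) (hclose : ‖w - w'‖ ≤ ε) :
    ∃ u : EuclideanSpace ℝ (Fin d), ‖u‖ = 1 ∧ ⟪u, w⟫ = 0 ∧ ‖v - u‖ ≤ ε := by
  obtain ⟨u, hu, huw, hle⟩ := exists_unit_orthogonal_inner_le_inner hv hw hw' horth
  exact ⟨u, hu, huw,
    ((norm_sub_le_norm_sub_iff_inner_le_inner hv hu hw hw').2 hle).trans hclose⟩
end

section
/- Smoothness of pushforwards under nondegenerate maps: let φ : B_1^d → B_1^d be a continuously differentiable map with Jacobian Dφ satisfying |det(Dφ(x))| ≥ c > 0 for all x ∈ B_1^d, and suppose there is N ∈ ℕ such that every fiber φ^{−1}(y) = {x ∈ B_1^d : φ(x) = y} has at most N elements. Then for every probability measure p on B_1^d that is σ-smooth with respect to μ_d, the pushforward measure φ_*p is (cσ/N)-smooth with respect to μ_d. -/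
open MeasureTheory Metric
open scoped ENNReal

/-- The uniform probability measure on the closed unit ball of `ℝ^d`. -/
noncomputable def unifBall (d : ℕ) : Measure (EuclideanSpace ℝ (Fin d)) :=
  (volume (closedBall (0 : EuclideanSpace ℝ (Fin d)) 1))⁻¹ •
    (volume.restrict (closedBall (0 : EuclideanSpace ℝ (Fin d)) 1))

/-- `p` is `σ`-smooth with respect to `μ`: `p B ≤ μ B / σ` for every measurable `B`. -/
def IsSmoothWrt {X : Type*} [MeasurableSpace X] (p μ : Measure X) (σ : ℝ) : Prop :=
  ∀ B : Set X, MeasurableSet B → p B ≤ μ B / ENNReal.ofReal σ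

/-- If pairwise disjoint sets `A i` lie in `K`, a point lies in at most as many of the images
`f '' A i` as its fibre in `K` has elements. -/
theorem sum_indicator_image_le_ncard_fiber {ι X Y : Type*} [Fintype ι] {K : Set X} {A : ι → Set X}
    (hA : Pairwise (Function.onFun Disjoint A)) (hAK : ∀ i, A i ⊆ K) (f : X → Y) (y : Y)
    (hfin : {x | x ∈ K ∧ f x = y}.Finite) :
    ∑ i, (f '' A i).indicator (1 : Y → ℝ≥0∞) y ≤ {x | x ∈ K ∧ f x = y}.ncard := by
  classical
  have hsum : ∑ i, (f '' A i).indicator (1 : Y → ℝ≥0∞) y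
      = (Finset.univ.filter fun i => y ∈ f '' A i).card := by
    simp [Set.indicator_apply, Finset.sum_boole]
  rw [hsum, Nat.cast_le, Set.ncard_eq_toFinset_card _ hfin]
  refine Finset.card_le_card_of_forall_subsingleton (fun i x => x ∈ A i) (fun i hi => ?_) ?_
  · obtain ⟨x, hx, hxy⟩ := (Finset.mem_filter.1 hi).2
    exact ⟨x, by simpa using And.intro (hAK i hx) hxy, hx⟩
  · intro x _ i hi j hj
    by_contra hne
    exact Set.disjoint_left.1 (hA hne) hi.2 hj.2

/-- A compact set on which `f` is locally injective splits into finitely many disjoint measurable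
pieces on which `f` is injective. -/
theorem IsCompact.exists_measurable_partition_injOn {X Y : Type*} [TopologicalSpace X]
    [MeasurableSpace X] [OpensMeasurableSpace X] {K : Set X} (hK : IsCompact K)
    (hKm : MeasurableSet K) {f : X → Y} (hf : ∀ x ∈ K, ∃ U : Set X, IsOpen U ∧ x ∈ U ∧ U.InjOn f) :
    ∃ (n : ℕ) (A : Fin n → Set X), (∀ i, MeasurableSet (A i)) ∧
      Pairwise (Function.onFun Disjoint A) ∧ ⋃ i, A i = K ∧ ∀ i, (A i).InjOn f := by
  choose! U hUo hxU hUf using hf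
  obtain ⟨t, htK, hKt⟩ := hK.elim_nhds_subcover U fun x hx => (hUo x hx).mem_nhds (hxU x hx)
  let V : Fin t.card → Set X := fun i => U (t.equivFin.symm i)
  have hV : ∀ i, (t.equivFin.symm i : X) ∈ K := fun i => htK _ (t.equivFin.symm i).2
  refine ⟨t.card, fun i => K ∩ disjointed V i, fun i => ?_, fun i j hij => ?_, ?_, fun i => ?_⟩
  · exact hKm.inter
      (disjointedRec (fun _ _ h => h.diff (hUo _ (hV _)).measurableSet) (hUo _ (hV i)).measurableSet)
  · exact (disjoint_disjointed V hij).mono Set.inter_subset_right Set.inter_subset_right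
  · rw [← Set.inter_iUnion, iUnion_disjointed, Set.inter_eq_left]
    intro x hx
    obtain ⟨z, hz, hxz⟩ := Set.mem_iUnion₂.1 (hKt hx)
    exact Set.mem_iUnion.2 ⟨t.equivFin ⟨z, hz⟩, by simpa [V] using hxz⟩
  · exact (hUf _ (hV i)).mono (Set.inter_subset_right.trans (disjointed_subset V i))

/-- If `f` is `C¹` with `|det Df| ≥ c > 0` on a compact set `K` which it maps into `L`, and its
fibres in `K` have at most `N` elements, then `c * μ (K ∩ f ⁻¹' B) ≤ N * μ (B ∩ L)`. -/
theorem mul_addHaar_inter_preimage_le {E : Type*} [NormedAddCommGroup E] [NormedSpace ℝ E]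
    [FiniteDimensional ℝ E] [MeasurableSpace E] [BorelSpace E] (μ : Measure E)
    [μ.IsAddHaarMeasure] {f : E → E} (hf : ContDiff ℝ 1 f) {K L : Set E} (hK : IsCompact K)
    (hL : MeasurableSet L) (hKL : Set.MapsTo f K L) {c : ℝ} (hc : 0 < c)
    (hdet : ∀ x ∈ K, c ≤ |(fderiv ℝ f x).det|) {N : ℕ}
    (hfib : ∀ y, Set.ncard {x | x ∈ K ∧ f x = y} ≤ N) {B : Set E} (hB : MeasurableSet B) :
    ENNReal.ofReal c * μ (K ∩ f ⁻¹' B) ≤ N * μ (B ∩ L) := by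
  have hinj : ∀ x ∈ K, ∃ U : Set E, IsOpen U ∧ x ∈ U ∧ U.InjOn f := by
    intro x hx
    have hdet0 : (fderiv ℝ f x).det ≠ 0 := abs_pos.1 (hc.trans_le (hdet x hx))
    have hstrict : HasStrictFDerivAt f
        ((fderiv ℝ f x).toContinuousLinearEquivOfDetNeZero hdet0 : E →L[ℝ] E) x := by
      simpa using hf.contDiffAt.hasStrictFDerivAt one_ne_zero
    exact ⟨_, (hstrict.toOpenPartialHomeomorph f).open_source,
      hstrict.mem_toOpenPartialHomeomorph_source, (hstrict.toOpenPartialHomeomorph f).injOn⟩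
  obtain ⟨n, A, hAm, hAd, hAK, hAf⟩ :=
    hK.exists_measurable_partition_injOn hK.measurableSet hinj
  have hAsub : ∀ i, A i ⊆ K := fun i => hAK ▸ Set.subset_iUnion A i
  have hfin : ∀ y, {x | x ∈ K ∧ f x = y}.Finite := by
    intro y
    refine (Set.finite_iUnion fun i => Set.Subsingleton.finite
      (s := {x | x ∈ A i ∧ f x = y}) ?_).subset ?_
    · exact fun a ha b hb => hAf i ha.1 hb.1 (ha.2.trans hb.2.symm)
    · rintro x ⟨hx, hxy⟩
      obtain ⟨i, hi⟩ := Set.mem_iUnion.1 (hAK.symm ▸ hx)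
      exact Set.mem_iUnion.2 ⟨i, hi, hxy⟩
  have hfB : MeasurableSet (f ⁻¹' B) := hf.continuous.measurable hB
  have hderiv : ∀ i, ∀ x ∈ A i ∩ f ⁻¹' B,
      HasFDerivWithinAt f (fderiv ℝ f x) (A i ∩ f ⁻¹' B) x := fun i x _ =>
    ((hf.differentiable one_ne_zero) x).hasFDerivAt.hasFDerivWithinAt
  have himage : ∀ i, MeasurableSet (f '' (A i ∩ f ⁻¹' B)) := fun i =>
    measurable_image_of_fderivWithin ((hAm i).inter hfB) (hderiv i)
      ((hAf i).mono Set.inter_subset_left)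
  calc ENNReal.ofReal c * μ (K ∩ f ⁻¹' B)
      ≤ ENNReal.ofReal c * ∑ i, μ (A i ∩ f ⁻¹' B) := by
        rw [← hAK, Set.iUnion_inter]
        gcongr
        exact measure_iUnion_fintype_le μ _
    _ = ∑ i, ENNReal.ofReal c * μ (A i ∩ f ⁻¹' B) := Finset.mul_sum _ _ _
    _ ≤ ∑ i, μ (f '' (A i ∩ f ⁻¹' B)) := by
        gcongr with i
        rw [← lintegral_abs_det_fderiv_eq_addHaar_image μ ((hAm i).inter hfB) (hderiv i)
          ((hAf i).mono Set.inter_subset_left), ← setLIntegral_const]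
        exact setLIntegral_mono' ((hAm i).inter hfB) fun x hx =>
          ENNReal.ofReal_le_ofReal (hdet x (hAsub i hx.1))
    _ = ∫⁻ y, ∑ i, (f '' (A i ∩ f ⁻¹' B)).indicator 1 y ∂μ := by
        rw [lintegral_finsetSum _ fun i _ => measurable_one.indicator (himage i)]
        simp_rw [lintegral_indicator_one (himage _)]
    _ ≤ ∫⁻ y, (B ∩ L).indicator (fun _ => (N : ℝ≥0∞)) y ∂μ := by
        refine lintegral_mono fun y => ?_
        by_cases hy : y ∈ B ∩ L
        · rw [Set.indicator_of_mem hy]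
          exact (sum_indicator_image_le_ncard_fiber
            (fun i j hij => (hAd hij).mono Set.inter_subset_left Set.inter_subset_left)
            (fun i => Set.inter_subset_left.trans (hAsub i)) f y (hfin y)).trans
            (Nat.cast_le.2 (hfib y))
        · rw [Set.indicator_of_notMem hy]
          refine (Finset.sum_eq_zero fun i _ => Set.indicator_of_notMem ?_ _).le
          rintro ⟨x, hx, rfl⟩
          exact hy ⟨hx.2, hKL (hAsub i hx.1)⟩
    _ = N * μ (B ∩ L) := lintegral_indicator_const (hB.inter hL) _


/-- **Smoothness of pushforwards under nondegenerate maps.**  If `φ : B_1^d → B_1^d` is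
`C¹` with `|det Dφ| ≥ c > 0` on the ball and every fiber of `φ` over the ball has at
most `N` elements, then the pushforward under `φ` of any `σ`-smooth (w.r.t. `μ_d`)
probability measure on `B_1^d` is `(cσ/N)`-smooth with respect to `μ_d`. -/
theorem pushforward_smooth_of_nondegenerate (d : ℕ) (c σ : ℝ) (N : ℕ)
    (hc : 0 < c) (hσ0 : 0 < σ) (hσ1 : σ ≤ 1) (hN : 1 ≤ N)
    (φ : EuclideanSpace ℝ (Fin d) → EuclideanSpace ℝ (Fin d))
    (hφ : ContDiff ℝ 1 φ)
    (hmap : ∀ x ∈ closedBall (0 : EuclideanSpace ℝ (Fin d)) 1,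
      φ x ∈ closedBall (0 : EuclideanSpace ℝ (Fin d)) 1)
    (hdet : ∀ x ∈ closedBall (0 : EuclideanSpace ℝ (Fin d)) 1, c ≤ |(fderiv ℝ φ x).det|)
    (hfib : ∀ y : EuclideanSpace ℝ (Fin d),
      Set.ncard {x | x ∈ closedBall (0 : EuclideanSpace ℝ (Fin d)) 1 ∧ φ x = y} ≤ N)
    (p : Measure (EuclideanSpace ℝ (Fin d))) [IsProbabilityMeasure p]
    (hsupp : p (closedBall (0 : EuclideanSpace ℝ (Fin d)) 1)ᶜ = 0)
    (hsmooth : IsSmoothWrt p (unifBall d) σ) :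
    IsSmoothWrt (Measure.map φ p) (unifBall d) (c * σ / N) := by
  intro B hB
  have hK := isCompact_closedBall (0 : EuclideanSpace ℝ (Fin d)) 1
  have hfB : MeasurableSet (φ ⁻¹' B) := hφ.continuous.measurable hB
  have hbound := mul_addHaar_inter_preimage_le volume hφ hK measurableSet_closedBall hmap hc hdet
    hfib hB
  have hN0 : (0 : ℝ) < N := by exact_mod_cast hN
  have hc0 : ENNReal.ofReal c ≠ 0 := by simpa using hc
  have hle : unifBall d (φ ⁻¹' B) ≤ N / ENNReal.ofReal c * unifBall d B := by
    simp only [unifBall, Measure.smul_apply, smul_eq_mul, Measure.restrict_apply hB,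
      Measure.restrict_apply hfB]
    rw [mul_left_comm, Set.inter_comm (φ ⁻¹' B)]
    gcongr
    rw [ENNReal.div_eq_inv_mul, mul_assoc, ← ENNReal.div_eq_inv_mul,
      ENNReal.le_div_iff_mul_le (Or.inl hc0) (Or.inl ENNReal.ofReal_ne_top), mul_comm]
    exact hbound
  rw [Measure.map_apply hφ.continuous.measurable hB]
  calc p (φ ⁻¹' B) ≤ unifBall d (φ ⁻¹' B) / ENNReal.ofReal σ := hsmooth _ hfB
    _ ≤ N / ENNReal.ofReal c * unifBall d B / ENNReal.ofReal σ := by gcongr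
    _ = unifBall d B / ENNReal.ofReal (c * σ / N) := by
        rw [ENNReal.ofReal_div_of_pos hN0, ENNReal.ofReal_mul hc.le, ENNReal.ofReal_natCast]
        simp only [div_eq_mul_inv]
        rw [ENNReal.mul_inv (Or.inr (by simp; lia)) (Or.inr (by simp)), inv_inv,
          ENNReal.mul_inv (Or.inl hc0) (Or.inl ENNReal.ofReal_ne_top)]
        ring
end

section
/- Coordinatewise monotone feature maps preserve smoothness: let α > 0 and let φ_1, …, φ_d : ℝ → ℝ be differentiable functions with φ_i′(u) ≥ α for all u ∈ [−1, 1], and suppose the map φ(x) = (φ_1(x_1), …, φ_d(x_d)) maps B_1^d into B_1^d. Then φ is injective on B_1^d, |det(Dφ(x))| ≥ α^d for all x ∈ B_1^d, and for every probability measure p on B_1^d that is σ-smooth with respect to μ_d, the pushforward φ_*p is (α^d·σ)-smooth with respect to μ_d. -/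
open MeasureTheory Metric
open scoped ENNReal

section CoordinatewiseMap

variable {d : ℕ} {φ : Fin d → ℝ → ℝ}
  {Φ : EuclideanSpace ℝ (Fin d) → EuclideanSpace ℝ (Fin d)}

theorem EuclideanSpace.apply_mem_Icc_of_mem_closedBall {x : EuclideanSpace ℝ (Fin d)}
    (hx : x ∈ closedBall (0 : EuclideanSpace ℝ (Fin d)) 1) (i : Fin d) :
    x i ∈ Set.Icc (-1 : ℝ) 1 := by
  rw [mem_closedBall_zero_iff] at hx
  have h := (PiLp.norm_apply_le x i).trans hx
  rwa [Real.norm_eq_abs, abs_le] at h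

theorem hasFDerivAt_coordinatewise (hdiff : ∀ i, Differentiable ℝ (φ i))
    (hΦ : ∀ x i, Φ x i = φ i (x i)) (x : EuclideanSpace ℝ (Fin d)) :
    HasFDerivAt Φ
      (Matrix.toEuclideanCLM (n := Fin d) (𝕜 := ℝ)
        (Matrix.diagonal fun i => deriv (φ i) (x i))) x := by
  rw [← hasFDerivWithinAt_univ, hasFDerivWithinAt_euclidean]
  intro i
  rw [hasFDerivWithinAt_univ]
  simp only [hΦ]
  have h := (hdiff i (x i)).hasDerivAt.comp_hasFDerivAt x
    (EuclideanSpace.proj (𝕜 := ℝ) i).hasFDerivAt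
  refine h.congr_fderiv ?_
  ext v
  simp [Matrix.mulVec_diagonal]

theorem det_fderiv_coordinatewise (hdiff : ∀ i, Differentiable ℝ (φ i))
    (hΦ : ∀ x i, Φ x i = φ i (x i)) (x : EuclideanSpace ℝ (Fin d)) :
    (fderiv ℝ Φ x).det = ∏ i, deriv (φ i) (x i) := by
  rw [(hasFDerivAt_coordinatewise hdiff hΦ x).fderiv, ContinuousLinearMap.det,
    Matrix.coe_toEuclideanCLM_eq_toEuclideanLin, Matrix.toEuclideanLin, Matrix.toLpLin_eq_toLin,
    LinearMap.det_toLin, Matrix.det_diagonal]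

theorem injOn_coordinatewise {s : Set ℝ} {t : Set (EuclideanSpace ℝ (Fin d))}
    (hφ : ∀ i, Set.InjOn (φ i) s) (hΦ : ∀ x i, Φ x i = φ i (x i))
    (ht : ∀ x ∈ t, ∀ i, x i ∈ s) : Set.InjOn Φ t := by
  intro x hx y hy hxy
  ext i
  exact hφ i (ht x hx i) (ht y hy i) (by rw [← hΦ, ← hΦ, hxy])

end CoordinatewiseMap

/-- A differentiable injective map whose Jacobian determinant is at least `c` on a measurable
set expands its volume by a factor of at least `c`. -/
theorem ofReal_mul_volume_le_volume_image {E : Type*} [NormedAddCommGroup E] [NormedSpace ℝ E]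
    [FiniteDimensional ℝ E] [MeasurableSpace E] [BorelSpace E] (μ : Measure E)
    [μ.IsAddHaarMeasure] {f : E → E} {f' : E → E →L[ℝ] E} {s : Set E} {c : ℝ}
    (hs : MeasurableSet s) (hf' : ∀ x ∈ s, HasFDerivWithinAt f (f' x) s x)
    (hf : Set.InjOn f s) (hc : ∀ x ∈ s, c ≤ |(f' x).det|) :
    ENNReal.ofReal c * μ s ≤ μ (f '' s) := by
  rw [← lintegral_abs_det_fderiv_eq_addHaar_image μ hs hf' hf, ← setLIntegral_const]
  exact setLIntegral_mono' hs fun x hx => ENNReal.ofReal_le_ofReal (hc x hx)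

/-- The pushforward of a `σ`-smooth measure on the unit ball under an injective self-map of the
ball with Jacobian determinant at least `c` is `c * σ`-smooth. -/
theorem IsSmoothWrt.map_unifBall {d : ℕ} {p : Measure (EuclideanSpace ℝ (Fin d))} {σ c : ℝ}
    {f : EuclideanSpace ℝ (Fin d) → EuclideanSpace ℝ (Fin d)} (hp : IsSmoothWrt p (unifBall d) σ)
    (hc : 0 < c) (hf : Differentiable ℝ f)
    (hmap : Set.MapsTo f (closedBall 0 1) (closedBall 0 1))
    (hinj : Set.InjOn f (closedBall 0 1))
    (hdet : ∀ x ∈ closedBall (0 : EuclideanSpace ℝ (Fin d)) 1, c ≤ |(fderiv ℝ f x).det|) :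
    IsSmoothWrt (Measure.map f p) (unifBall d) (c * σ) := by
  intro B hB
  have hfm : Measurable f := hf.continuous.measurable
  set K := closedBall (0 : EuclideanSpace ℝ (Fin d)) 1 with hK
  have hKm : MeasurableSet K := isClosed_closedBall.measurableSet
  have hAm : MeasurableSet (f ⁻¹' B ∩ K) := (hfm hB).inter hKm
  have hvol : ENNReal.ofReal c * volume (f ⁻¹' B ∩ K) ≤ volume (B ∩ K) := by
    refine (ofReal_mul_volume_le_volume_image volume hAm
      (fun x _ => (hf x).hasFDerivAt.hasFDerivWithinAt) (hinj.mono Set.inter_subset_right)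
      fun x hx => hdet x hx.2).trans (measure_mono ?_)
    rintro _ ⟨x, hx, rfl⟩
    exact ⟨hx.1, hmap hx.2⟩
  have hunif : unifBall d (f ⁻¹' B) ≤ unifBall d B / ENNReal.ofReal c := by
    rw [ENNReal.le_div_iff_mul_le (.inl (by simpa using hc)) (.inl ENNReal.ofReal_ne_top)]
    simp only [unifBall, Measure.smul_apply, smul_eq_mul, Measure.restrict_apply hB,
      Measure.restrict_apply (hfm hB), ← hK]
    rw [mul_assoc, mul_comm (volume _) (ENNReal.ofReal c)]
    gcongr
  rw [Measure.map_apply hfm hB]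
  calc p (f ⁻¹' B) ≤ unifBall d (f ⁻¹' B) / ENNReal.ofReal σ := hp _ (hfm hB)
    _ ≤ unifBall d B / ENNReal.ofReal c / ENNReal.ofReal σ := by gcongr
    _ = unifBall d B / ENNReal.ofReal (c * σ) := by
      rw [ENNReal.ofReal_mul hc.le, div_eq_mul_inv, div_eq_mul_inv, div_eq_mul_inv,
        ENNReal.mul_inv (.inl (by simpa using hc)) (.inl ENNReal.ofReal_ne_top), mul_assoc]

/-- **Coordinatewise monotone feature maps preserve smoothness.**  If each `φ i : ℝ → ℝ`
is differentiable with `φ i ' (u) ≥ α > 0` on `[-1,1]` and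
`Φ x = (φ 1 (x 1), …, φ d (x d))` maps `B_1^d` into `B_1^d`, then `Φ` is injective on
`B_1^d`, `|det DΦ(x)| ≥ α^d` on `B_1^d`, and pushing forward any `σ`-smooth probability
measure on `B_1^d` along `Φ` yields an `α^d·σ`-smooth measure with respect to `μ_d`. -/
theorem coordinatewise_monotone_smooth (d : ℕ) (α σ : ℝ)
    (hα : 0 < α) (hσ0 : 0 < σ) (hσ1 : σ ≤ 1)
    (φ : Fin d → ℝ → ℝ)
    (hdiff : ∀ i, Differentiable ℝ (φ i))
    (hderiv : ∀ i, ∀ u ∈ Set.Icc (-1 : ℝ) 1, α ≤ deriv (φ i) u)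
    (Φ : EuclideanSpace ℝ (Fin d) → EuclideanSpace ℝ (Fin d))
    (hΦ : ∀ x i, Φ x i = φ i (x i))
    (hmap : ∀ x ∈ closedBall (0 : EuclideanSpace ℝ (Fin d)) 1,
      Φ x ∈ closedBall (0 : EuclideanSpace ℝ (Fin d)) 1) :
    Set.InjOn Φ (closedBall (0 : EuclideanSpace ℝ (Fin d)) 1) ∧
    (∀ x ∈ closedBall (0 : EuclideanSpace ℝ (Fin d)) 1, α ^ d ≤ |(fderiv ℝ Φ x).det|) ∧
    ∀ p : Measure (EuclideanSpace ℝ (Fin d)), IsProbabilityMeasure p →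
      p (closedBall (0 : EuclideanSpace ℝ (Fin d)) 1)ᶜ = 0 →
      IsSmoothWrt p (unifBall d) σ →
      IsSmoothWrt (Measure.map Φ p) (unifBall d) (α ^ d * σ) := by
  have hinj : Set.InjOn Φ (closedBall 0 1) := by
    refine injOn_coordinatewise (s := Set.Icc (-1) 1) (fun i => ?_) hΦ
      fun x hx => EuclideanSpace.apply_mem_Icc_of_mem_closedBall hx
    exact (strictMonoOn_of_deriv_pos (convex_Icc _ _) (hdiff i).continuous.continuousOn
      fun u hu => hα.trans_le (hderiv i u (interior_subset hu))).injOn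
  have hdet : ∀ x ∈ closedBall (0 : EuclideanSpace ℝ (Fin d)) 1,
      α ^ d ≤ |(fderiv ℝ Φ x).det| := by
    intro x hx
    rw [det_fderiv_coordinatewise hdiff hΦ]
    refine le_trans ?_ (le_abs_self _)
    calc α ^ d = ∏ _i : Fin d, α := by simp
      _ ≤ ∏ i, deriv (φ i) (x i) := Finset.prod_le_prod (fun _ _ => hα.le) fun i _ =>
        hderiv i _ (EuclideanSpace.apply_mem_Icc_of_mem_closedBall hx i)
  refine ⟨hinj, hdet, fun p _ _ hp => hp.map_unifBall (pow_pos hα d) ?_ hmap hinj hdet⟩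
  exact fun x => (hasFDerivAt_coordinatewise hdiff hΦ x).differentiableAt
end

section
/- Perceptron mistake bound with margin errors: let (x̄_1, y_1), …, (x̄_T, y_T) ∈ ℝ^n × {−1,+1} with ‖x̄_i‖ ≤ R for all i, and let the online Perceptron iterates be defined by w_1 = 0 and w_{i+1} = w_i + y_i·x̄_i if sign(⟨w_i, x̄_i⟩) ≠ y_i (a mistake), w_{i+1} = w_i otherwise. Fix a unit vector w̄ ∈ ℝ^n and γ ∈ (0, R), and set N_1 = #{i : sign(y_i·⟨x̄_i, w̄⟩) = −1} and N_2 = #{i : y_i·⟨x̄_i, w̄⟩ ∈ [0, γ]}. Then the total number of mistakes satisfies #{i : sign(⟨w_i, x̄_i⟩) ≠ y_i} ≤ (8·N_1 + 4)·R²/γ² + 2·N_2. -/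
open Finset
open scoped RealInnerProductSpace Classical

/-- `sgn u = 1` if `u ≥ 0` and `-1` otherwise. -/
noncomputable def sgn (u : ℝ) : ℝ := if 0 ≤ u then 1 else -1

section Perceptron

variable {E : Type*} [NormedAddCommGroup E] [InnerProductSpace ℝ E]

lemma sgn_eq_neg_one_iff {u : ℝ} : sgn u = -1 ↔ u < 0 := by
  unfold sgn
  split_ifs with h
  · norm_num [h]
  · simpa using h

lemma mul_nonpos_of_sgn_ne {u y : ℝ} (hy : y = 1 ∨ y = -1) (h : sgn u ≠ y) : y * u ≤ 0 := by
  unfold sgn at h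
  split_ifs at h with hu <;> rcases hy with rfl | rfl
  · exact absurd rfl h
  · linarith
  · linarith
  · exact absurd rfl h

/-- Each mistake increases the squared norm of the Perceptron iterate by at most `R ^ 2`. -/
lemma norm_sq_perceptron_le {T : ℕ} {R : ℝ} {x w : ℕ → E} {y : ℕ → ℝ}
    (hy : ∀ i, y i = 1 ∨ y i = -1) (hx : ∀ i ∈ Finset.Icc 1 T, ‖x i‖ ≤ R) (hw1 : w 1 = 0)
    (hwrec : ∀ i ∈ Finset.Icc 1 T,
      w (i + 1) = if sgn ⟪w i, x i⟫ ≠ y i then w i + y i • x i else w i) :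
    ‖w (T + 1)‖ ^ 2 ≤
      R ^ 2 * (((Finset.Icc 1 T).filter fun i => sgn ⟪w i, x i⟫ ≠ y i).card : ℝ) := by
  induction T with
  | zero => simp [hw1]
  | succ k ih =>
    have hsub : Finset.Icc 1 k ⊆ Finset.Icc 1 (k + 1) := Finset.Icc_subset_Icc_right k.le_succ
    have hmem : k + 1 ∈ Finset.Icc 1 (k + 1) := by simp
    have ih := ih (fun i hi => hx i (hsub hi)) (fun i hi => hwrec i (hsub hi))
    rw [Finset.card_filter] at ih ⊢
    rw [Finset.sum_Icc_succ_top (by omega), hwrec _ hmem]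
    push_cast at ih ⊢
    by_cases hm : sgn ⟪w (k + 1), x (k + 1)⟫ ≠ y (k + 1)
    · rw [if_pos hm, if_pos hm, norm_add_sq_real, real_inner_smul_right, norm_smul]
      have hip := mul_nonpos_of_sgn_ne (hy _) hm
      have hy1 : ‖y (k + 1)‖ = 1 := by rcases hy (k + 1) with h | h <;> simp [h]
      have hxR := pow_le_pow_left₀ (norm_nonneg _) (hx _ hmem) 2
      rw [hy1, one_mul]
      linarith
    · rw [if_neg hm, if_neg hm]
      linarith

/-- Each mistake on an example with margin greater than `γ` increases the correlation with `v` by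
at least `γ`; the remaining mistakes are charged to the two kinds of margin errors. -/
lemma mul_card_mistakes_le_inner_add {T : ℕ} {R γ : ℝ} (hγ : 0 ≤ γ) {x w : ℕ → E} {y : ℕ → ℝ}
    (hy : ∀ i, y i = 1 ∨ y i = -1) (hx : ∀ i ∈ Finset.Icc 1 T, ‖x i‖ ≤ R) (hw1 : w 1 = 0)
    (hwrec : ∀ i ∈ Finset.Icc 1 T,
      w (i + 1) = if sgn ⟪w i, x i⟫ ≠ y i then w i + y i • x i else w i)
    {v : E} (hv : ‖v‖ = 1) :
    γ * (((Finset.Icc 1 T).filter fun i => sgn ⟪w i, x i⟫ ≠ y i).card : ℝ) ≤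
      ⟪w (T + 1), v⟫ +
        (γ + R) * (((Finset.Icc 1 T).filter fun i => sgn (y i * ⟪x i, v⟫) = -1).card : ℝ) +
        γ * (((Finset.Icc 1 T).filter fun i => y i * ⟪x i, v⟫ ∈ Set.Icc 0 γ).card : ℝ) := by
  induction T with
  | zero => simp [hw1]
  | succ k ih =>
    have hsub : Finset.Icc 1 k ⊆ Finset.Icc 1 (k + 1) := Finset.Icc_subset_Icc_right k.le_succ
    have hmem : k + 1 ∈ Finset.Icc 1 (k + 1) := by simp
    have ih := ih (fun i hi => hx i (hsub hi)) (fun i hi => hwrec i (hsub hi))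
    have hxR := hx _ hmem
    have hR : 0 ≤ R := (norm_nonneg _).trans hxR
    have hlow : -R ≤ y (k + 1) * ⟪x (k + 1), v⟫ := by
      have h := abs_real_inner_le_norm (x (k + 1)) v
      rw [hv, mul_one] at h
      have := abs_le.1 (h.trans hxR)
      rcases hy (k + 1) with h | h <;> rw [h] <;> linarith
    simp only [Finset.card_filter] at ih ⊢
    simp only [Finset.sum_Icc_succ_top (show 1 ≤ k + 1 by omega), hwrec _ hmem]
    push_cast at ih ⊢
    simp only [sgn_eq_neg_one_iff, Set.mem_Icc] at ih ⊢
    by_cases hm : sgn ⟪w (k + 1), x (k + 1)⟫ ≠ y (k + 1)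
    · rw [if_pos hm, if_pos hm, inner_add_left, real_inner_smul_left]
      split_ifs <;> grind
    · rw [if_neg hm, if_neg hm]
      split_ifs <;> linarith

end Perceptron

/-- **Perceptron mistake bound with margin errors.**  For examples
`(x̄ i, y i) ∈ ℝ^n × {±1}` with `‖x̄ i‖ ≤ R`, Perceptron iterates `w 1 = 0`,
`w (i+1) = w i + y i • x̄ i` on mistakes (`sgn ⟪w i, x̄ i⟫ ≠ y i`) and `w (i+1) = w i`
otherwise, any unit vector `w̄` and `γ ∈ (0, R)`, with
`N₁ = #{i : sgn (y i·⟪x̄ i, w̄⟫) = -1}` and `N₂ = #{i : y i·⟪x̄ i, w̄⟫ ∈ [0, γ]}`, the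
number of mistakes is at most `(8·N₁ + 4)·R²/γ² + 2·N₂`. -/
theorem perceptron_mistake_bound (n T : ℕ) (R γ : ℝ)
    (hR : 0 < R) (hγ0 : 0 < γ) (hγR : γ < R)
    (x : ℕ → EuclideanSpace ℝ (Fin n)) (y : ℕ → ℝ)
    (hy : ∀ i, y i = 1 ∨ y i = -1)
    (hx : ∀ i ∈ Finset.Icc 1 T, ‖x i‖ ≤ R)
    (w : ℕ → EuclideanSpace ℝ (Fin n)) (hw1 : w 1 = 0)
    (hwrec : ∀ i ∈ Finset.Icc 1 T,
      w (i + 1) = if sgn ⟪w i, x i⟫ ≠ y i then w i + y i • x i else w i)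
    (wbar : EuclideanSpace ℝ (Fin n)) (hwbar : ‖wbar‖ = 1) :
    (((Finset.Icc 1 T).filter fun i => sgn ⟪w i, x i⟫ ≠ y i).card : ℝ) ≤
      (8 * (((Finset.Icc 1 T).filter fun i => sgn (y i * ⟪x i, wbar⟫) = -1).card : ℝ) + 4) *
          R ^ 2 / γ ^ 2 +
        2 * (((Finset.Icc 1 T).filter fun i => y i * ⟪x i, wbar⟫ ∈ Set.Icc 0 γ).card : ℝ) := by
  have hnorm := norm_sq_perceptron_le hy hx hw1 hwrec
  have hcorr := mul_card_mistakes_le_inner_add hγ0.le hy hx hw1 hwrec hwbar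
  have hcs := real_inner_le_norm (w (T + 1)) wbar
  rw [hwbar, mul_one] at hcs
  set M : ℝ := (((Finset.Icc 1 T).filter fun i => sgn ⟪w i, x i⟫ ≠ y i).card : ℝ)
  set N₁ : ℝ := (((Finset.Icc 1 T).filter fun i => sgn (y i * ⟪x i, wbar⟫) = -1).card : ℝ)
  set N₂ : ℝ := (((Finset.Icc 1 T).filter fun i => y i * ⟪x i, wbar⟫ ∈ Set.Icc 0 γ).card : ℝ)
  have hN₁ : 0 ≤ N₁ := Nat.cast_nonneg _
  set a := ‖w (T + 1)‖
  have hγM : γ * M ≤ a + (γ + R) * N₁ + γ * N₂ := by linarith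
  have hamgm : 2 * γ * a ≤ γ ^ 2 * M + R ^ 2 := by
    have h : R ^ 2 * (2 * γ * a) ≤ R ^ 2 * (γ ^ 2 * M + R ^ 2) := by
      nlinarith [sq_nonneg (γ * a - R ^ 2), mul_le_mul_of_nonneg_left hnorm (sq_nonneg γ)]
    exact le_of_mul_le_mul_left h (by positivity)
  have hcoef : γ * (γ + R) * N₁ ≤ 2 * R ^ 2 * N₁ :=
    mul_le_mul_of_nonneg_right (by nlinarith) hN₁
  have hmain : γ ^ 2 * M ≤ (8 * N₁ + 4) * R ^ 2 + 2 * N₂ * γ ^ 2 := by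
    nlinarith [mul_le_mul_of_nonneg_left hγM hγ0.le, mul_nonneg hN₁ (sq_nonneg R), sq_nonneg R]
  rw [div_add' _ _ _ (by positivity), le_div_iff₀ (by positivity)]
  linarith
end

section
/- Small-margin probability bound: let w* ∈ ℝ^d and b* ∈ ℝ satisfy (b*)² + ‖w*‖² = 1 and ‖w*‖ ≥ 1/2, set ŵ* = w*/‖w*‖ and y*(x) = sign(b* + ⟨x, w*⟩). Let x be a random vector in ℝ^d with law p. Then for every bounded interval I₀ ⊆ ℝ of length |I₀|, p({x : y*(x)·(b* + ⟨x, w*⟩) ∈ I₀}) ≤ 2·sup_{a ∈ ℝ} p({x : ⟨x, ŵ*⟩ ∈ [a, a + 2|I₀|]}). In particular, for every γ > 0, p({x : y*(x)·(b* + ⟨x, w*⟩) ≤ γ}) ≤ 2·sup_{a ∈ ℝ} p({x : ⟨x, ŵ*⟩ ∈ [a, a + 2γ]}) (using that y*(x)·(b* + ⟨x, w*⟩) ≥ 0 always, so the event is {y*(x)·(b* + ⟨x, w*⟩) ∈ [0, γ]}). -/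
open MeasureTheory
open scoped ENNReal RealInnerProductSpace

theorem sgn_mul_self (u : ℝ) : sgn u * u = |u| := by
  unfold sgn
  split_ifs with h
  · rw [one_mul, abs_of_nonneg h]
  · rw [neg_one_mul, abs_of_neg (not_le.mp h)]

/-- An affine margin with weight of norm at least `1 / 2` lies in an interval of length `L` with
probability at most the concentration of the normalized projection at scale `2 * L`. -/
theorem measure_affine_mem_Icc_le {E : Type*} [NormedAddCommGroup E] [InnerProductSpace ℝ E]
    [MeasurableSpace E] (p : Measure E) {w : E} (hw : 1 / 2 ≤ ‖w‖) (b c : ℝ) {L : ℝ}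
    (hL : 0 ≤ L) :
    p {x | b + ⟪x, w⟫ ∈ Set.Icc c (c + L)} ≤
      ⨆ a : ℝ, p {x | ⟪x, ‖w‖⁻¹ • w⟫ ∈ Set.Icc a (a + 2 * L)} := by
  have hpos : 0 < ‖w‖ := by linarith
  refine le_iSup_of_le (‖w‖⁻¹ * (c - b)) (measure_mono ?_)
  rintro x ⟨h₁, h₂⟩
  have hinv : ‖w‖⁻¹ ≤ 2 := by
    rw [inv_le_comm₀ hpos two_pos]
    linarith
  simp only [Set.mem_ofPred_eq, real_inner_smul_right, Set.mem_Icc]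
  constructor
  · gcongr
    linarith
  · calc ‖w‖⁻¹ * ⟪x, w⟫ ≤ ‖w‖⁻¹ * (c - b + L) := by
          gcongr
          linarith
      _ = ‖w‖⁻¹ * (c - b) + ‖w‖⁻¹ * L := mul_add _ _ _
      _ ≤ ‖w‖⁻¹ * (c - b) + 2 * L := by gcongr

/-- **Small-margin probability bound.**  Let `(b*)² + ‖w*‖² = 1` with `‖w*‖ ≥ 1/2`,
`ŵ* = w*/‖w*‖` and `y*(x) = sign(b* + ⟪x, w*⟫)`.  For a random vector with law `p`:
for every bounded interval `[a₀, a₀ + L]`,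
`p(y*(x)·(b* + ⟪x, w*⟫) ∈ [a₀, a₀+L]) ≤ 2·sup_a p(⟪x, ŵ*⟫ ∈ [a, a+2L])`; and for every
`γ > 0`, `p(y*(x)·(b* + ⟪x, w*⟫) ≤ γ) ≤ 2·sup_a p(⟪x, ŵ*⟫ ∈ [a, a+2γ])`. -/
theorem small_margin_probability_bound (d : ℕ)
    (wstar : EuclideanSpace ℝ (Fin d)) (bstar : ℝ)
    (hnorm : bstar ^ 2 + ‖wstar‖ ^ 2 = 1) (hwhalf : 1 / 2 ≤ ‖wstar‖)
    (p : Measure (EuclideanSpace ℝ (Fin d))) [IsProbabilityMeasure p] :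
    (∀ a₀ L : ℝ, 0 ≤ L →
      p {x | sgn (bstar + ⟪x, wstar⟫) * (bstar + ⟪x, wstar⟫) ∈ Set.Icc a₀ (a₀ + L)} ≤
        2 * ⨆ a : ℝ, p {x | ⟪x, ‖wstar‖⁻¹ • wstar⟫ ∈ Set.Icc a (a + 2 * L)}) ∧
    ∀ γ : ℝ, 0 < γ →
      p {x | sgn (bstar + ⟪x, wstar⟫) * (bstar + ⟪x, wstar⟫) ≤ γ} ≤
        2 * ⨆ a : ℝ, p {x | ⟪x, ‖wstar‖⁻¹ • wstar⟫ ∈ Set.Icc a (a + 2 * γ)} := by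
  have main : ∀ a₀ L : ℝ, 0 ≤ L →
      p {x | sgn (bstar + ⟪x, wstar⟫) * (bstar + ⟪x, wstar⟫) ∈ Set.Icc a₀ (a₀ + L)} ≤
        2 * ⨆ a : ℝ, p {x | ⟪x, ‖wstar‖⁻¹ • wstar⟫ ∈ Set.Icc a (a + 2 * L)} := by
    intro a₀ L hL
    rw [two_mul (⨆ a : ℝ, _)]
    refine (measure_mono ?_).trans ((measure_union_le _ _).trans (add_le_add
      (measure_affine_mem_Icc_le p hwhalf bstar a₀ hL)
      (measure_affine_mem_Icc_le p hwhalf bstar (-(a₀ + L)) hL)))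
    intro x hx
    rw [Set.mem_ofPred_eq, sgn_mul_self, Set.mem_Icc] at hx
    rcases abs_choice (bstar + ⟪x, wstar⟫) with h | h <;> rw [h] at hx
    · exact Or.inl hx
    · exact Or.inr ⟨by linarith, by linarith⟩
  refine ⟨main, fun γ hγ => (measure_mono ?_).trans (main 0 γ hγ.le)⟩
  intro x hx
  refine ⟨?_, by simpa using hx⟩
  rw [sgn_mul_self]
  exact abs_nonneg _
end
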